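/- Let q ≥ 2 be an integer and let n', k be positive integers with gcd(n'·k, q) = 1, and set m' = ord_{n'}(q). Say that a prime r belongs to π*(n') if r divides n' and ν_r(n') = ν_r(q^{m'} − 1). Then ord_{k·n'}(q) = k·m' if and only if every prime divisor of k belongs to π*(n') and, in addition, whenever 2 ∈ π*(n') and n' ≡ 2 (mod 4), one has ν_2(k) ≤ 1. (Proposition 4.5, prop_nn0rChar.) -/

import Mathlib

/-- The multiplicative order of `q` modulo `N`: the least positive integer `i`
such that `N` divides `q ^ i - 1`. -/
noncomputable def multOrd (q N : ℕ) : ℕ := sInf {i : ℕ | 0 < i ∧ N ∣ q ^ i - 1}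

theorem natCast_zmod_pow_eq_one_iff {q N i : ℕ} (hq : 0 < q) :
    (q : ZMod N) ^ i = 1 ↔ N ∣ q ^ i - 1 := by
  rw [← Nat.modEq_iff_dvd' (Nat.one_le_pow _ _ hq), ← ZMod.natCast_eq_natCast_iff, eq_comm]
  push_cast
  rfl

theorem orderOf_natCast_zmod_pos {q N : ℕ} (hN : 0 < N) (hco : q.Coprime N) :
    0 < orderOf (q : ZMod N) := by
  have : NeZero N := ⟨hN.ne'⟩
  rw [← ZMod.coe_unitOfCoprime q hco, orderOf_units]
  exact orderOf_pos _

theorem multOrd_eq_orderOf {q N : ℕ} (hq : 0 < q) (hN : 0 < N) (hco : q.Coprime N) :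
    multOrd q N = orderOf (q : ZMod N) := by
  have hpos := orderOf_natCast_zmod_pos hN hco
  have hmem : orderOf (q : ZMod N) ∈ {i : ℕ | 0 < i ∧ N ∣ q ^ i - 1} :=
    ⟨hpos, (natCast_zmod_pow_eq_one_iff hq).1 (pow_orderOf_eq_one _)⟩
  refine le_antisymm (Nat.sInf_le hmem) (le_csInf ⟨_, hmem⟩ ?_)
  rintro i ⟨hi, hdvd⟩
  exact orderOf_le_of_pow_eq_one hi ((natCast_zmod_pow_eq_one_iff hq).2 hdvd)

/-- If `Q ≡ 1 [MOD n]` has order `k` modulo `k * n`, its powers exhaust the residues that are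
`1` modulo `n`. -/
theorem exists_pow_modEq_one_add_mul {Q n k : ℕ} (hk : 0 < k) (hQ : 0 < Q)
    (h : n ∣ Q - 1) (hord : orderOf (Q : ZMod (k * n)) = k) (t : ℕ) :
    ∃ i, Q ^ i ≡ 1 + n * t [MOD k * n] := by
  have hdiv (i : ℕ) : Q ^ i = 1 + n * ((Q ^ i - 1) / n) := by
    have h1 : n ∣ Q ^ i - 1 := h.trans (by simpa using Nat.sub_dvd_pow_sub_pow Q 1 i)
    have h2 := Nat.one_le_pow i Q hQ
    rw [Nat.mul_div_cancel' h1]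
    omega
  have hlift {a b : ℕ} (hab : a ≡ b [MOD k]) : 1 + n * a ≡ 1 + n * b [MOD k * n] := by
    rw [mul_comm k n]
    exact (Nat.ModEq.mul_left' n hab).add_left 1
  let f : Fin k → Fin k := fun i => ⟨(Q ^ (i : ℕ) - 1) / n % k, Nat.mod_lt _ hk⟩
  have hinj : Function.Injective f := by
    intro i j hij
    have hmod : (Q ^ (i : ℕ) - 1) / n ≡ (Q ^ (j : ℕ) - 1) / n [MOD k] := congrArg Fin.val hij
    have hpow := hlift hmod
    rw [← hdiv, ← hdiv, ← ZMod.natCast_eq_natCast_iff] at hpow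
    push_cast at hpow
    exact Fin.ext (pow_injOn_Iio_orderOf (by simp [hord]) (by simp [hord]) hpow)
  obtain ⟨i, hi⟩ := Finite.injective_iff_surjective.1 hinj ⟨t % k, Nat.mod_lt _ hk⟩
  have hmod : (Q ^ (i : ℕ) - 1) / n ≡ t [MOD k] := congrArg Fin.val hi
  refine ⟨i, ?_⟩
  rw [hdiv i]
  exact hlift hmod

theorem dvd_of_prime_dvd_of_orderOf_eq {Q n k r : ℕ} (hn : 0 < n) (hk : 0 < k) (hQ : 0 < Q)
    (h : n ∣ Q - 1) (hco : Q.Coprime k) (hord : orderOf (Q : ZMod (k * n)) = k)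
    (hr : r.Prime) (hrk : r ∣ k) : r ∣ n := by
  by_contra hrn
  have hc : n.Coprime r := ((Nat.Prime.coprime_iff_not_dvd hr).2 hrn).symm
  obtain ⟨y, hy1, hyr⟩ := Nat.chineseRemainder hc 1 0
  have hy : r ∣ y + n * r := ((Nat.modEq_zero_iff_dvd).1 hyr).add (dvd_mul_left r n)
  have hpos : 1 ≤ y + n * r := by have := Nat.mul_pos hn hr.pos; omega
  have hny : n ∣ y + n * r - 1 := by
    rw [← Nat.modEq_iff_dvd' hpos]
    exact hy1.symm.trans (by simp [Nat.ModEq])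
  obtain ⟨t, ht⟩ := hny
  obtain ⟨i, hi⟩ := exists_pow_modEq_one_add_mul hk hQ h hord t
  rw [show 1 + n * t = y + n * r by omega] at hi
  have hrQ : r ∣ Q ^ i := (hi.dvd_iff (hrk.mul_right n)).2 hy
  exact hr.one_lt.ne' (Nat.dvd_one.1 (hco ▸ Nat.dvd_gcd (hr.dvd_of_dvd_pow hrQ) hrk))

theorem padicValNat_eq_of_orderOf_eq {Q n k r : ℕ} (hn : 0 < n) (hk : 0 < k) (hQ : 1 < Q)
    (h : n ∣ Q - 1) (hord : orderOf (Q : ZMod (k * n)) = k)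
    (hr : r.Prime) (hrk : r ∣ k) : padicValNat r n = padicValNat r (Q - 1) := by
  have : Fact r.Prime := ⟨hr⟩
  have hQ1 : Q - 1 ≠ 0 := by omega
  refine le_antisymm ((padicValNat_dvd_iff_le hQ1).1 (pow_padicValNat_dvd.trans h)) ?_
  by_contra! hlt
  have hdQ : r ^ (padicValNat r n + 1) ∣ Q - 1 := (padicValNat_dvd_iff_le hQ1).2 hlt
  have hdkn : r ^ (padicValNat r n + 1) ∣ k * n := by
    rw [pow_succ']
    exact mul_dvd_mul hrk pow_padicValNat_dvd
  obtain ⟨i, hi⟩ := exists_pow_modEq_one_add_mul hk (by omega) h hord 1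
  have hQi : Q ^ i ≡ 1 [MOD r ^ (padicValNat r n + 1)] := by
    simpa using ((Nat.modEq_iff_dvd' hQ.le).2 hdQ).symm.pow i
  have hn1 : 1 + n * 1 ≡ 1 + 0 [MOD r ^ (padicValNat r n + 1)] :=
    (hi.of_dvd hdkn).symm.trans hQi
  have hdn := (Nat.modEq_zero_iff_dvd).1 (Nat.ModEq.add_left_cancel' 1 hn1)
  rw [mul_one, padicValNat_dvd_iff_le hn.ne'] at hdn
  omega

theorem not_four_dvd_of_orderOf_eq {Q n k : ℕ} (hk : 0 < k) (hQ : 1 < Q)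
    (h : n ∣ Q - 1) (hord : orderOf (Q : ZMod (k * n)) = k) (hn4 : n % 4 = 2)
    (hval : padicValNat 2 n = padicValNat 2 (Q - 1)) : ¬ 4 ∣ k := by
  intro h4
  have hn : 0 < n := by omega
  have hQ4 : Q % 4 = 3 := by
    have h2Q : 2 ∣ Q - 1 := (show 2 ∣ n by omega).trans h
    have hn4' : ¬ 2 ^ 2 ∣ n := by omega
    have hQ4' : ¬ 2 ^ 2 ∣ Q - 1 := by
      rw [padicValNat_dvd_iff_le (by omega), ← hval, ← padicValNat_dvd_iff_le hn.ne']
      exact hn4'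
    omega
  have h8 : 8 ∣ k * n := mul_dvd_mul h4 (show 2 ∣ n by omega)
  obtain ⟨i, hi⟩ := exists_pow_modEq_one_add_mul hk (by omega) h hord 2
  have hi8 : Q ^ i % 8 = 5 := by
    have := hi.of_dvd h8
    unfold Nat.ModEq at this
    omega
  rcases Nat.even_or_odd' i with ⟨j, rfl | rfl⟩
  · have hsq : Q ^ 2 ≡ 1 [MOD 8] := by
      have : Q % 8 = 3 ∨ Q % 8 = 7 := by omega
      rcases this with h | h <;> simp [Nat.ModEq, Nat.pow_mod, h]
    have := hsq.pow j
    rw [← pow_mul, one_pow] at this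
    unfold Nat.ModEq at this
    omega
  · have hsq : Q ^ 2 ≡ 1 [MOD 4] := by simp [Nat.ModEq, Nat.pow_mod, hQ4]
    have := (hsq.pow j).mul_right Q
    rw [← pow_mul, one_pow, ← pow_succ, one_mul] at this
    unfold Nat.ModEq at this
    omega

theorem mul_dvd_pow_sub_one {Q n : ℕ} (h : n ∣ Q - 1) (k : ℕ)
    (hk : ∀ r : ℕ, r.Prime → r ∣ k → r ∣ n) (hQ : 0 < Q) : k * n ∣ Q ^ k - 1 := by
  induction k using induction_on_primes with
  | zero => simp
  | one => simpa using h
  | prime_mul p a hp ih =>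
    have hn := ih fun r hr hra => hk r hr (hra.mul_left p)
    have hpQ : p ∣ Q ^ a - 1 :=
      ((hk p hp (dvd_mul_right p a)).trans h).trans (by simpa using Nat.sub_dvd_pow_sub_pow Q 1 a)
    have hQa := Nat.one_le_pow a Q hQ
    have hgeom : p ∣ ∑ i ∈ Finset.range p, (Q ^ a) ^ i := by
      rw [← Nat.modEq_zero_iff_dvd]
      have hone : Q ^ a ≡ 1 [MOD p] := ((Nat.modEq_iff_dvd' hQa).2 hpQ).symm
      rw [← ZMod.natCast_eq_natCast_iff] at hone ⊢
      push_cast at hone ⊢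
      simp [hone]
    have := mul_dvd_mul hgeom hn
    rwa [geom_sum_mul_of_one_le hQa, ← pow_mul, mul_comm a p, ← mul_assoc] at this

theorem emultiplicity_pow_sub_one {Q r j : ℕ} (hr : r.Prime) (hQ : 0 < Q) (h : r ∣ Q - 1)
    (hj : Odd r ∨ 4 ∣ Q - 1 ∨ ¬ r ∣ j) :
    emultiplicity r (Q ^ j - 1) = emultiplicity r (Q - 1) + emultiplicity r j := by
  have hrQ : ¬ r ∣ Q := fun h' => hr.one_lt.ne' <| Nat.dvd_one.1 <|
    (Nat.dvd_sub_iff_right hQ h').1 h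
  by_cases hj' : Odd r
  · simpa using Nat.emultiplicity_pow_sub_pow hr hj' (x := Q) (y := 1) h hrQ j
  have hr2 : r = 2 := hr.eq_two_or_odd'.resolve_right hj'
  have hQj := Nat.one_le_pow j Q hQ
  have hdvd : (r : ℤ) ∣ (Q : ℤ) - 1 := by
    rw [← Nat.cast_one, ← Nat.cast_sub hQ]
    exact_mod_cast h
  have hndvd : ¬ (r : ℤ) ∣ (Q : ℤ) := by exact_mod_cast hrQ
  simp only [← Int.natCast_emultiplicity]
  rw [Nat.cast_sub hQj, Nat.cast_sub (show 1 ≤ Q from hQ), Nat.cast_pow, Nat.cast_one]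
  rcases hj with hj | hj | hj
  · exact absurd hj hj'
  · subst hr2
    have h4 : (4 : ℤ) ∣ (Q : ℤ) - 1 := by omega
    simpa using Int.two_pow_sub_pow' j h4 hndvd
  · have hrj : ¬ (r : ℤ) ∣ (j : ℤ) := by exact_mod_cast hj
    rw [emultiplicity_eq_zero.2 hrj, add_zero]
    simpa using emultiplicity_pow_sub_pow_of_prime (Nat.prime_iff_prime_int.1 hr)
      (y := 1) hdvd hndvd hrj

theorem orderOf_eq_of_padicValNat_eq {Q n k : ℕ} (hn : 0 < n) (hk : 0 < k) (hQ : 1 < Q)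
    (h : n ∣ Q - 1)
    (hr : ∀ r : ℕ, r.Prime → r ∣ k → r ∣ n ∧ padicValNat r n = padicValNat r (Q - 1))
    (h4 : n % 4 = 2 → ¬ 4 ∣ k) : orderOf (Q : ZMod (k * n)) = k := by
  refine orderOf_eq_of_pow_and_pow_div_prime hk
    ((natCast_zmod_pow_eq_one_iff (by omega)).2
      (mul_dvd_pow_sub_one h k (fun r hp hrk => (hr r hp hrk).1) (by omega))) ?_
  rintro r hp ⟨j, rfl⟩
  rw [Ne, natCast_zmod_pow_eq_one_iff (by omega), Nat.mul_div_cancel_left _ hp.pos]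
  intro hdvd
  have : Fact r.Prime := ⟨hp⟩
  obtain ⟨hrn, hval⟩ := hr r hp (dvd_mul_right r j)
  have hj : j ≠ 0 := by rintro rfl; simp at hk
  have hQ1 : Q - 1 ≠ 0 := by omega
  have hQj : Q ^ j - 1 ≠ 0 := by have := Nat.one_lt_pow hj hQ; omega
  have hcases : Odd r ∨ 4 ∣ Q - 1 ∨ ¬ r ∣ j := by
    rcases hp.eq_two_or_odd' with rfl | hodd
    · by_cases hj2 : 2 ∣ j
      · have h4n : n % 4 ≠ 2 := fun h2 => h4 h2 (mul_dvd_mul (dvd_refl 2) hj2)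
        exact .inr (.inl ((show 4 ∣ n by omega).trans h))
      · exact .inr (.inr hj2)
    · exact .inl hodd
  have hlte := emultiplicity_pow_sub_one hp (by omega) (hrn.trans h) hcases
  have hle := emultiplicity_le_emultiplicity_of_dvd_right (a := r) hdvd
  rw [hlte, ← padicValNat_eq_emultiplicity hQ1, ← padicValNat_eq_emultiplicity hj,
    ← padicValNat_eq_emultiplicity (by positivity), padicValNat.mul (by positivity) hn.ne',
    padicValNat.mul hp.ne_zero hj, padicValNat_self, hval] at hle
  norm_cast at hle
  omega

theorem orderOf_natCast_zmod_mul_eq {q n k : ℕ} (hn : 0 < n) (hco : q.Coprime n) :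
    orderOf (q : ZMod (k * n)) =
      orderOf ((q ^ orderOf (q : ZMod n) : ℕ) : ZMod (k * n)) * orderOf (q : ZMod n) := by
  have hdvd : orderOf (q : ZMod n) ∣ orderOf (q : ZMod (k * n)) := by
    simpa using orderOf_map_dvd (ZMod.castHom (dvd_mul_left n k) (ZMod n)).toMonoidHom
      (q : ZMod (k * n))
  rw [Nat.cast_pow, orderOf_pow_of_dvd (orderOf_natCast_zmod_pos hn hco).ne' hdvd,
    Nat.div_mul_cancel hdvd]

/-- Proposition 4.5, prop_nn0rChar: with `m' = ord_{n'}(q)`, one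
has `ord_{k·n'}(q) = k·m'` if and only if every prime divisor `r` of `k`
satisfies `r ∣ n'` and `ν_r(n') = ν_r(q^{m'} - 1)` (i.e. `r ∈ π*(n')`), and in
addition, whenever `2 ∈ π*(n')` and `n' ≡ 2 (mod 4)`, one has `ν_2(k) ≤ 1`. -/
theorem stmt7 (q n' k : ℕ) (hq : 2 ≤ q) (hn' : 0 < n') (hk : 0 < k)
    (hco : Nat.gcd (n' * k) q = 1) (m' : ℕ) (hm' : m' = multOrd q n') :
    multOrd q (k * n') = k * m' ↔
      ((∀ r : ℕ, r.Prime → r ∣ k →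
          r ∣ n' ∧ padicValNat r n' = padicValNat r (q ^ m' - 1)) ∧
        (((2 ∣ n' ∧ padicValNat 2 n' = padicValNat 2 (q ^ m' - 1)) ∧ n' % 4 = 2) →
          padicValNat 2 k ≤ 1)) := by
  have hq0 : 0 < q := by omega
  have hqn : q.Coprime n' := (Nat.Coprime.coprime_mul_right hco).symm
  have hqk : q.Coprime k := (Nat.Coprime.coprime_mul_left hco).symm
  rw [multOrd_eq_orderOf hq0 hn' hqn] at hm'
  have hm0 : 0 < m' := hm' ▸ orderOf_natCast_zmod_pos hn' hqn
  have hQ : 1 < q ^ m' := Nat.one_lt_pow hm0.ne' hq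
  have hdvd : n' ∣ q ^ m' - 1 :=
    (natCast_zmod_pow_eq_one_iff hq0).1 (hm' ▸ pow_orderOf_eq_one _)
  rw [multOrd_eq_orderOf hq0 (Nat.mul_pos hk hn') (hqk.mul_right hqn),
    orderOf_natCast_zmod_mul_eq hn' hqn, ← hm', Nat.mul_left_inj hm0.ne']
  have hval4 : padicValNat 2 k ≤ 1 ↔ ¬ 4 ∣ k := by
    rw [show 4 = 2 ^ 2 by norm_num, padicValNat_dvd_iff_le hk.ne']
    omega
  rw [hval4]
  constructor
  · intro hord
    refine ⟨fun r hr hrk => ⟨?_, ?_⟩, fun h => ?_⟩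
    · exact dvd_of_prime_dvd_of_orderOf_eq hn' hk (by omega) hdvd (hqk.pow_left m') hord hr hrk
    · exact padicValNat_eq_of_orderOf_eq hn' hk hQ hdvd hord hr hrk
    · exact not_four_dvd_of_orderOf_eq hk hQ hdvd hord h.2 h.1.2
  · rintro ⟨hr, h4⟩
    refine orderOf_eq_of_padicValNat_eq hn' hk hQ hdvd hr fun hn4 hk4 => ?_
    exact h4 ⟨hr 2 Nat.prime_two ((by norm_num : 2 ∣ 4).trans hk4), hn4⟩ hk4
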